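/- arXiv:2408.16085 — 2 statements merged into one kernel-verified Lean document; each statement's English description precedes it below -/
import Mathlib

section
/- Let 𝒳 be a hereditary family of finite simple graphs (i.e., closed under taking induced subgraphs) and let a, b be positive real numbers such that every graph H ∈ 𝒳 with ν vertices and μ edges satisfies cr(H) ≥ a·μ − b·ν. Then every graph G ∈ 𝒳 with n ≥ 1 vertices and m edges satisfying 2·a·m ≥ 3·b·n has cr(G) ≥ (4·a³/(27·b²))·(m³/n²). -/
open unitInterval

/-- A (good) drawing of a simple graph in the plane: vertices map to distinct
points, each edge is drawn as a simple continuous arc between its endpoints,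
arcs avoid vertex points other than their endpoints, two arcs meet in finitely
many points, and no three arcs pass through a common interior point. -/
structure PlaneDrawing {V : Type*} (G : SimpleGraph V) where
  pos : V → ℝ × ℝ
  pos_inj : Function.Injective pos
  arc : ∀ ⦃u v : V⦄, G.Adj u v → Path (pos u) (pos v)
  arc_symm : ∀ ⦃u v : V⦄ (h : G.Adj u v), arc h.symm = (arc h).symm
  arc_inj : ∀ ⦃u v : V⦄ (h : G.Adj u v), Function.Injective (arc h)
  no_vertex_mem : ∀ ⦃u v : V⦄ (h : G.Adj u v) (w : V) (t : I),
      arc h t = pos w → w = u ∨ w = v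
  finite_inter : ∀ ⦃u v x y : V⦄ (h₁ : G.Adj u v) (h₂ : G.Adj x y),
      s(u, v) ≠ s(x, y) →
      (Set.range (arc h₁) ∩ Set.range (arc h₂)).Finite
  no_triple_point : ∀ ⦃u₁ v₁ u₂ v₂ u₃ v₃ : V⦄
      (h₁ : G.Adj u₁ v₁) (h₂ : G.Adj u₂ v₂) (h₃ : G.Adj u₃ v₃),
      s(u₁, v₁) ≠ s(u₂, v₂) → s(u₁, v₁) ≠ s(u₃, v₃) → s(u₂, v₂) ≠ s(u₃, v₃) →
      ∀ t₁ t₂ t₃ : I, t₁ ≠ 0 → t₁ ≠ 1 → t₂ ≠ 0 → t₂ ≠ 1 → t₃ ≠ 0 → t₃ ≠ 1 →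
      arc h₁ t₁ = arc h₂ t₂ → arc h₂ t₂ = arc h₃ t₃ → False

namespace PlaneDrawing

variable {V : Type*} {G : SimpleGraph V} (D : PlaneDrawing G)

/-- `p` is an interior point of the arc of the edge `uv`. -/
def IsInteriorPoint {u v : V} (h : G.Adj u v) (p : ℝ × ℝ) : Prop :=
  ∃ t : I, t ≠ 0 ∧ t ≠ 1 ∧ D.arc h t = p

/-- The set of crossing points of the drawing: points where the interiors of
the arcs of two distinct edges meet. -/
def crossings : Set (ℝ × ℝ) :=
  {p | ∃ (u v x y : V) (h₁ : G.Adj u v) (h₂ : G.Adj x y),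
    s(u, v) ≠ s(x, y) ∧ D.IsInteriorPoint h₁ p ∧ D.IsInteriorPoint h₂ p}

/-- The number of crossings of the drawing. -/
noncomputable def crossingCount : ℕ := D.crossings.ncard

/-- The set of crossing points lying on the edge `uv`. -/
def edgeCrossings {u v : V} (h : G.Adj u v) : Set (ℝ × ℝ) :=
  {p | D.IsInteriorPoint h p ∧
    ∃ (x y : V) (h₂ : G.Adj x y), s(u, v) ≠ s(x, y) ∧ D.IsInteriorPoint h₂ p}

/-- A drawing is `k`-plane if every edge is involved in at most `k` crossings. -/
def IsKPlane (k : ℕ) : Prop :=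
  ∀ ⦃u v : V⦄ (h : G.Adj u v), (D.edgeCrossings h).ncard ≤ k

end PlaneDrawing

/-- The crossing number of a graph: the minimum number of crossings over all
drawings. -/
noncomputable def crossingNumber {V : Type*} (G : SimpleGraph V) : ℕ :=
  sInf {c : ℕ | ∃ D : PlaneDrawing G, D.crossingCount = c}

/-- A graph is `k`-planar if it admits a drawing in which every edge is
involved in at most `k` crossings. -/
def KPlanar {V : Type*} (G : SimpleGraph V) (k : ℕ) : Prop :=
  ∃ D : PlaneDrawing G, D.IsKPlane k

/-- `G` has no cycle of length `ℓ`. -/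
def HasNoCycleOfLength {V : Type*} (G : SimpleGraph V) (ℓ : ℕ) : Prop :=
  ∀ (v : V) (c : G.Walk v v), c.IsCycle → c.length ≠ ℓ

section Arcs

open Set

/-- `S` is a simple arc from `a` to `b`. -/
def IsSimpleArc {X : Type*} [TopologicalSpace X] (a b : X) (S : Set X) : Prop :=
  ∃ γ : Path a b, Function.Injective γ ∧ range γ = S

namespace IsSimpleArc

variable {X Y : Type*} [TopologicalSpace X] [TopologicalSpace Y] {a b c : X} {S T : Set X}

lemma left_mem (h : IsSimpleArc a b S) : a ∈ S := by
  obtain ⟨γ, -, rfl⟩ := h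
  exact γ.source_mem_range

lemma right_mem (h : IsSimpleArc a b S) : b ∈ S := by
  obtain ⟨γ, -, rfl⟩ := h
  exact γ.target_mem_range

lemma isCompact (h : IsSimpleArc a b S) : IsCompact S := by
  obtain ⟨γ, -, rfl⟩ := h
  exact isCompact_range γ.continuous

lemma symm (h : IsSimpleArc a b S) : IsSimpleArc b a S := by
  obtain ⟨γ, hγ, rfl⟩ := h
  exact ⟨γ.symm, hγ.comp symm_bijective.injective, γ.symm_range⟩

lemma image (h : IsSimpleArc a b S) {f : X → Y} (hf : Continuous f)
    (hinj : Function.Injective f) : IsSimpleArc (f a) (f b) (f '' S) := by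
  obtain ⟨γ, hγ, rfl⟩ := h
  exact ⟨γ.map hf, hinj.comp hγ, by rw [Path.map_coe, range_comp]⟩

lemma trans (h₁ : IsSimpleArc a b S) (h₂ : IsSimpleArc b c T) (h : S ∩ T ⊆ {b}) :
    IsSimpleArc a c (S ∪ T) := by
  obtain ⟨γ, hγ, rfl⟩ := h₁
  obtain ⟨δ, hδ, rfl⟩ := h₂
  refine ⟨γ.trans δ, ?_, Path.trans_range _ _⟩
  have key : ∀ s t : I, (s : ℝ) ≤ 1 / 2 → ¬ (t : ℝ) ≤ 1 / 2 →
      γ.trans δ s ≠ γ.trans δ t := by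
    intro s t hs ht hst
    rw [Path.trans_apply, Path.trans_apply, dif_pos hs, dif_neg ht] at hst
    have hb := h ⟨⟨_, rfl⟩, ⟨_, hst.symm⟩⟩
    rw [mem_singleton_iff, hst] at hb
    have h0 := congrArg Subtype.val (hδ (hb.trans δ.source.symm))
    simp only [Icc.coe_zero] at h0
    linarith
  intro s t hst
  by_cases hs : (s : ℝ) ≤ 1 / 2 <;> by_cases ht : (t : ℝ) ≤ 1 / 2
  · rw [Path.trans_apply, Path.trans_apply, dif_pos hs, dif_pos ht] at hst
    have := congrArg Subtype.val (hγ hst)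
    simp only at this
    exact Subtype.ext (by linarith)
  · exact absurd hst (key s t hs ht)
  · exact absurd hst.symm (key t s ht hs)
  · rw [Path.trans_apply, Path.trans_apply, dif_neg hs, dif_neg ht] at hst
    have := congrArg Subtype.val (hδ hst)
    simp only at this
    exact Subtype.ext (by linarith)

lemma of_subpath {γ : Path a b} (hγ : Function.Injective γ) {s t : I} (hst : s < t) :
    IsSimpleArc (γ s) (γ t) (γ '' Icc s t) := by
  refine ⟨γ.subpath s t, ?_, γ.range_subpath_of_le s t hst.le⟩
  refine hγ.comp fun x y hxy ↦ ?_
  have h := congrArg Subtype.val hxy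
  simp only [Icc.coe_convexComb] at h
  have hst' : (0 : ℝ) < t - s := sub_pos.2 hst
  have : ((t : ℝ) - s) * (x - y) = 0 := by linear_combination h
  rcases mul_eq_zero.1 this with h' | h'
  · exact absurd h' hst'.ne'
  · exact Subtype.ext (sub_eq_zero.1 h')

lemma of_subpath_zero {γ : Path a b} (hγ : Function.Injective γ) {t : I} (ht : 0 < t) :
    IsSimpleArc a (γ t) (γ '' Icc 0 t) := by
  simpa using of_subpath hγ ht

lemma of_subpath_one {γ : Path a b} (hγ : Function.Injective γ) {t : I} (ht : t < 1) :
    IsSimpleArc (γ t) b (γ '' Icc t 1) := by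
  simpa using of_subpath hγ ht

end IsSimpleArc

lemma isSimpleArc_segment {E : Type*} [AddCommGroup E] [Module ℝ E] [TopologicalSpace E]
    [ContinuousAdd E] [ContinuousSMul ℝ E] {x y : E} (h : x ≠ y) :
    IsSimpleArc x y (segment ℝ x y) :=
  ⟨Path.segment x y, Path.segment_injective_of_ne h, Path.range_segment x y⟩

namespace Path

variable {X : Type*} [TopologicalSpace X] {a b c : X}

lemma exists_first_mem (γ : Path a b) {K : Set X} (hK : IsClosed K) {t₀ : I} (h : γ t₀ ∈ K) :
    ∃ t ≤ t₀, γ t ∈ K ∧ ∀ t' < t, γ t' ∉ K := by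
  obtain ⟨t, ht, hmin⟩ := (hK.preimage γ.continuous).isCompact.exists_isLeast ⟨t₀, h⟩
  exact ⟨t, hmin h, ht, fun t' ht' hm ↦ (hmin hm).not_gt ht'⟩

/-- Follow `β` up to its first meeting point with the final part of `α`, then follow `α`. -/
lemma exists_splice [T2Space X] {α : Path a b} {β : Path a c} (hα : Function.Injective α)
    (hβ : Function.Injective β) (hb : b ∉ range β) {s₀ t₀ : I} (hs₀ : s₀ ≠ 0)
    (h : α s₀ = β t₀) :
    ∃ s t, s₀ ≤ s ∧ t ≤ t₀ ∧ β t = α s ∧ (∀ t' < t, β t' ∉ α '' Icc s₀ 1) ∧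
      IsSimpleArc a b (β '' Icc 0 t ∪ α '' Icc s 1) := by
  have hK : IsClosed (α '' Icc s₀ 1) := (isClosed_Icc.isCompact.image α.continuous).isClosed
  obtain ⟨t, ht, ⟨s, hs, hst⟩, hmin⟩ := β.exists_first_mem hK (t₀ := t₀)
    ⟨s₀, ⟨le_rfl, le_one'⟩, h⟩
  refine ⟨s, t, hs.1, ht, hst.symm, hmin, ?_⟩
  have h0s : 0 < s := (unitInterval.pos_iff_ne_zero.2 hs₀).trans_le hs.1
  have ht0 : 0 < t := by
    refine unitInterval.pos_iff_ne_zero.2 ?_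
    rintro rfl
    exact h0s.ne' (hα (hst.trans (β.source.trans α.source.symm)))
  have hs1 : s < 1 := by
    refine unitInterval.lt_one_iff_ne_one.2 ?_
    rintro rfl
    exact hb ⟨t, by rw [← hst, α.target]⟩
  have h₁ := IsSimpleArc.of_subpath_zero hβ ht0
  have h₂ := IsSimpleArc.of_subpath_one hα hs1
  rw [hst] at h₂
  refine h₁.trans h₂ ?_
  rintro _ ⟨⟨t', ht', rfl⟩, ⟨s', hs', hst'⟩⟩
  rcases ht'.2.lt_or_eq with hlt | rfl
  · exact absurd ⟨s', ⟨hs.1.trans hs'.1, hs'.2⟩, hst'⟩ (hmin t' hlt)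
  · rfl

lemma exists_enter_closedBall {E : Type*} [PseudoMetricSpace E] {a b p : E} (γ : Path a b)
    {r : ℝ} (hr : 0 < r) (ha : a ∉ Metric.closedBall p r) {s₀ : I} (hs₀ : γ s₀ = p) :
    ∃ s, 0 < s ∧ s < s₀ ∧ γ s ∈ Metric.sphere p r ∧ ∀ s' < s, γ s' ∉ Metric.closedBall p r := by
  obtain ⟨s, hs, hmem, hmin⟩ := γ.exists_first_mem (Metric.isClosed_closedBall (x := p) (ε := r))
    (t₀ := s₀) (by simp [hs₀, hr.le])
  have h0 : 0 < s := by
    refine unitInterval.pos_iff_ne_zero.2 ?_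
    rintro rfl
    exact ha (by simpa using hmem)
  have hball : γ s ∉ Metric.ball p r := by
    have hc : IsClosed {t | γ t ∉ Metric.ball p r} :=
      (Metric.isOpen_ball.isClosed_compl).preimage γ.continuous
    have hsub : Iio s ⊆ {t | γ t ∉ Metric.ball p r} :=
      fun t ht hb ↦ hmin t ht (Metric.ball_subset_closedBall hb)
    have hne : (Iio s).Nonempty := ⟨0, h0⟩
    exact closure_minimal hsub hc ((closure_Iio' hne).ge (mem_Iic.2 le_rfl))
  have hsph : γ s ∈ Metric.sphere p r := by
    rw [Metric.mem_sphere]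
    exact le_antisymm hmem (not_lt.1 hball)
  refine ⟨s, h0, lt_of_le_of_ne hs ?_, hsph, hmin⟩
  rintro rfl
  rw [hs₀, Metric.mem_sphere, dist_self] at hsph
  exact hr.ne hsph

lemma exists_exit_closedBall {E : Type*} [PseudoMetricSpace E] {a b p : E} (γ : Path a b)
    {r : ℝ} (hr : 0 < r) (hb : b ∉ Metric.closedBall p r) {s₀ : I} (hs₀ : γ s₀ = p) :
    ∃ s, s₀ < s ∧ s < 1 ∧ γ s ∈ Metric.sphere p r ∧ ∀ s' > s, γ s' ∉ Metric.closedBall p r := by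
  obtain ⟨s, h0, hs, hsph, hmin⟩ := γ.symm.exists_enter_closedBall hr hb (s₀ := σ s₀)
    (by simp [Path.symm, hs₀])
  refine ⟨σ s, ?_, ?_, hsph, fun s' hs' ↦ ?_⟩
  · rw [← unitInterval.symm_symm s₀]
    exact unitInterval.symm_lt_symm.2 hs
  · rw [← unitInterval.symm_zero]
    exact unitInterval.symm_lt_symm.2 h0
  · have := hmin (σ s') (by
      rw [← unitInterval.symm_symm s]
      exact unitInterval.symm_lt_symm.2 hs')
    simpa [Path.symm] using this

end Path

section Uncrossing

variable {E : Type*} [NormedAddCommGroup E] [InnerProductSpace ℝ E]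

lemma sbtw_of_mem_segment_inter {p P Q R W X : E} {r : ℝ} (hP : P ∈ Metric.sphere p r)
    (hQ : Q ∈ Metric.sphere p r) (hR : R ∈ Metric.sphere p r) (hW : W ∈ Metric.sphere p r)
    (hPR : P ≠ R) (hPW : P ≠ W) (hQR : Q ≠ R) (hQW : Q ≠ W) (hRW : R ≠ W)
    (hX : X ∈ segment ℝ P Q) (hX' : X ∈ segment ℝ R W) : Sbtw ℝ P X Q := by
  have hball := openSegment_subset_ball_of_ne (Metric.sphere_subset_closedBall hR)
    (Metric.sphere_subset_closedBall hW) hRW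
  have key : ∀ Z ∈ Metric.sphere p r, Z ≠ R → Z ≠ W → X ≠ Z := by
    rintro Z hZ hZR hZW rfl
    have := hball (mem_openSegment_of_ne_left_right hZR.symm hZW.symm hX')
    rw [Metric.mem_sphere] at hZ
    exact (Metric.mem_ball.1 this).ne hZ
  exact ⟨mem_segment_iff_wbtw.1 hX, key P hP hPR hPW, key Q hQ hQR hQW⟩

/-- Of the two ways to join two points of a sphere to two others by chords, at most one makes
the chords meet. -/
lemma disjoint_chords {p P Q R W : E} {r : ℝ} (hP : P ∈ Metric.sphere p r)
    (hQ : Q ∈ Metric.sphere p r) (hR : R ∈ Metric.sphere p r) (hW : W ∈ Metric.sphere p r)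
    (hPQ : P ≠ Q) (hPR : P ≠ R) (hPW : P ≠ W) (hQR : Q ≠ R) (hQW : Q ≠ W) (hRW : R ≠ W) :
    Disjoint (segment ℝ P Q) (segment ℝ R W) ∨ Disjoint (segment ℝ R Q) (segment ℝ P W) := by
  by_contra! h
  obtain ⟨X, hX, hX'⟩ := not_disjoint_iff.1 h.1
  obtain ⟨Y, hY, hY'⟩ := not_disjoint_iff.1 h.2
  have cosph : ∀ s : Set E, s ⊆ Metric.sphere p r → EuclideanGeometry.Cospherical s :=
    fun s hs ↦ ⟨p, r, fun x hx ↦ hs hx⟩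
  have h₁ := EuclideanGeometry.mul_dist_add_mul_dist_eq_mul_dist_of_cospherical
    (a := P) (b := R) (c := Q) (d := W) (p := X)
    (cosph _ (by rintro x (rfl | rfl | rfl | rfl) <;> assumption))
    (EuclideanGeometry.angle_eq_pi_iff_sbtw.2
      (sbtw_of_mem_segment_inter hP hQ hR hW hPR hPW hQR hQW hRW hX hX'))
    (EuclideanGeometry.angle_eq_pi_iff_sbtw.2
      (sbtw_of_mem_segment_inter hR hW hP hQ hPR.symm hQR.symm hPW.symm hQW.symm hPQ hX' hX))
  have h₂ := EuclideanGeometry.mul_dist_add_mul_dist_eq_mul_dist_of_cospherical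
    (a := P) (b := R) (c := W) (d := Q) (p := Y)
    (cosph _ (by rintro x (rfl | rfl | rfl | rfl) <;> assumption))
    (EuclideanGeometry.angle_eq_pi_iff_sbtw.2
      (sbtw_of_mem_segment_inter hP hW hR hQ hPR hPQ hRW.symm hQW.symm hQR.symm hY' hY))
    (EuclideanGeometry.angle_eq_pi_iff_sbtw.2
      (sbtw_of_mem_segment_inter hR hQ hP hW hPR.symm hRW hPQ.symm hQW hPW hY hY'))
  rw [dist_comm W Q, dist_comm Q P] at h₂
  rw [dist_comm R Q, dist_comm W P] at h₁
  rw [dist_comm R Q] at h₂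
  have hpos := mul_pos (dist_pos.2 hPR) (dist_pos.2 hQW)
  linarith

/-- Two disjoint arcs, each touching a ball in its end only, can be joined by a chord. -/
lemma IsSimpleArc.join_chord {a b x y p : E} {r : ℝ} {S T : Set E} (hS : IsSimpleArc a x S)
    (hT : IsSimpleArc y b T) (hST : Disjoint S T) (hx : x ∈ Metric.closedBall p r)
    (hy : y ∈ Metric.closedBall p r) (hSx : S ∩ Metric.closedBall p r ⊆ {x})
    (hTy : T ∩ Metric.closedBall p r ⊆ {y}) : IsSimpleArc a b (S ∪ segment ℝ x y ∪ T) := by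
  have hxy : x ≠ y := fun h ↦ disjoint_left.1 hST hS.right_mem (h ▸ hT.left_mem)
  have hseg : segment ℝ x y ⊆ Metric.closedBall p r :=
    (convex_closedBall p r).segment_subset hx hy
  refine (hS.trans (isSimpleArc_segment hxy) fun z hz ↦ hSx ⟨hz.1, hseg hz.2⟩).trans hT ?_
  rintro z ⟨hz | hz, hz'⟩
  · exact absurd hz' (disjoint_left.1 hST hz)
  · exact hTy ⟨hz', hseg hz⟩

/-- Two arcs with a common starting point which meet in another point `p` can be replaced by arcs
with the same ends which no longer meet in `p`, without creating new meeting points. -/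
theorem exists_uncrossed_arcs {a b c p : E} {S T U : Set E} (hS : IsSimpleArc a b S)
    (hT : IsSimpleArc a c T) (hb : b ∉ T) (hc : c ∉ S) (hfin : (S ∩ T).Finite)
    (hp : p ∈ S ∩ T) (hpa : p ≠ a) (hU : U ∈ nhds p) :
    ∃ S' T', IsSimpleArc a b S' ∧ IsSimpleArc a c T' ∧ S' ⊆ S ∪ T ∪ U ∧ T' ⊆ S ∪ T ∪ U ∧
      S' ∩ T' ⊆ (S ∩ T) \ {p} := by
  obtain ⟨α, hα, rfl⟩ := hS
  obtain ⟨β, hβ, rfl⟩ := hT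
  obtain ⟨⟨s₀, hs₀⟩, ⟨t₀, ht₀⟩⟩ := hp
  have hs₀0 : s₀ ≠ 0 := by
    rintro rfl
    exact hpa (by rw [← hs₀, α.source])
  have ht₀0 : t₀ ≠ 0 := by
    rintro rfl
    exact hpa (by rw [← ht₀, β.source])
  have hmeet : α s₀ = β t₀ := hs₀.trans ht₀.symm
  obtain ⟨s, t, hs, ht, hst, hmin, hS'⟩ := Path.exists_splice hα hβ hb hs₀0 hmeet
  obtain ⟨t', s', ht', hs', hst', hmin', hT'⟩ := Path.exists_splice hβ hα hc ht₀0 hmeet.symm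
  by_cases htr : t < t₀ ∨ s' < s₀
  · have hts' : t < t' ∧ s' < s := by
      rcases htr with h | h
      · refine ⟨h.trans_le ht', (hs'.trans hs).lt_of_ne ?_⟩
        rintro rfl
        obtain rfl : s' = s₀ := le_antisymm hs' hs
        exact h.ne (hβ (hst.trans hmeet))
      · refine ⟨(ht.trans ht').lt_of_ne ?_, h.trans_le hs⟩
        rintro rfl
        obtain rfl : t = t₀ := le_antisymm ht ht'
        exact h.ne (hα (hst'.trans hmeet.symm))
    have hsub₁ : β '' Icc 0 t ∪ α '' Icc s 1 ⊆ range α ∪ range β :=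
      union_subset ((image_subset_range _ _).trans subset_union_right)
        ((image_subset_range _ _).trans subset_union_left)
    have hsub₂ : α '' Icc 0 s' ∪ β '' Icc t' 1 ⊆ range α ∪ range β :=
      union_subset ((image_subset_range _ _).trans subset_union_left)
        ((image_subset_range _ _).trans subset_union_right)
    refine ⟨_, _, hS', hT', hsub₁.trans subset_union_left, hsub₂.trans subset_union_left, ?_⟩
    rintro x ⟨hx₁, hx₂⟩
    refine ⟨?_, ?_⟩
    · rcases hx₁ with ⟨u, hu, rfl⟩ | ⟨u, hu, rfl⟩ <;> rcases hx₂ with ⟨v, hv, hv'⟩ | ⟨v, hv, hv'⟩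
      · exact ⟨⟨v, hv'⟩, ⟨u, rfl⟩⟩
      · have := hβ hv'
        subst this
        exact absurd (hu.2.trans_lt hts'.1) hv.1.not_gt
      · have := hα hv'
        subst this
        exact absurd (hv.2.trans_lt hts'.2) hu.1.not_gt
      · exact ⟨⟨u, rfl⟩, ⟨v, hv'⟩⟩
    · rintro rfl
      rcases htr with h | h
      · rcases hx₁ with ⟨u, hu, hu'⟩ | ⟨u, hu, hu'⟩
        · have := hβ (hu'.trans ht₀.symm)
          subst this
          exact h.not_ge hu.2
        · have := hα (hu'.trans hs₀.symm)
          subst this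
          have : s = u := le_antisymm hu.1 hs
          subst this
          exact h.ne (hβ (hst.trans hmeet))
      · rcases hx₂ with ⟨u, hu, hu'⟩ | ⟨u, hu, hu'⟩
        · have := hα (hu'.trans hs₀.symm)
          subst this
          exact h.not_ge hu.2
        · have := hβ (hu'.trans ht₀.symm)
          subst this
          have : t' = u := le_antisymm hu.1 ht'
          subst this
          exact h.ne (hα (hst'.trans hmeet.symm))
  push Not at htr
  obtain rfl : t = t₀ := le_antisymm ht htr.1
  obtain rfl : s' = s₀ := le_antisymm hs' htr.2
  have hpU : U ∩ ((range α ∩ range β) \ {p} ∪ {a, b, c})ᶜ ∈ nhds p := by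
    refine Filter.inter_mem hU (IsOpen.mem_nhds ?_ ?_)
    · exact ((hfin.subset sdiff_subset).union (by simp)).isClosed.isOpen_compl
    · rintro (h | h | h | h)
      · exact h.2 rfl
      · exact hpa h
      · exact hb ⟨t, ht₀.trans h⟩
      · exact hc ⟨s', hs₀.trans h⟩
  obtain ⟨r, hr, hrU⟩ := Metric.nhds_basis_closedBall.mem_iff.1 hpU
  have hmeet_p : ∀ x ∈ Metric.closedBall p r, x ∈ range α → x ∈ range β → x = p := by
    intro x hx h₁ h₂
    by_contra hne
    exact (hrU hx).2 (.inl ⟨⟨h₁, h₂⟩, hne⟩)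
  have haB : a ∉ Metric.closedBall p r := fun h ↦ (hrU h).2 (.inr (by simp))
  have hbB : b ∉ Metric.closedBall p r := fun h ↦ (hrU h).2 (.inr (by simp))
  have hcB : c ∉ Metric.closedBall p r := fun h ↦ (hrU h).2 (.inr (by simp))
  obtain ⟨s₁, hs₁0, hs₁, hs₁s, hs₁m⟩ := α.exists_enter_closedBall hr haB hs₀
  obtain ⟨s₂, hs₂, hs₂1, hs₂s, hs₂m⟩ := α.exists_exit_closedBall hr hbB hs₀
  obtain ⟨t₁, ht₁0, ht₁, ht₁s, ht₁m⟩ := β.exists_enter_closedBall hr haB ht₀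
  obtain ⟨t₂, ht₂, ht₂1, ht₂s, ht₂m⟩ := β.exists_exit_closedBall hr hcB ht₀
  have hne : ∀ u v, α u ∈ Metric.sphere p r → α u ≠ β v := by
    intro u v hu huv
    have := hmeet_p _ (Metric.sphere_subset_closedBall hu) ⟨u, rfl⟩ ⟨v, huv.symm⟩
    rw [this, Metric.mem_sphere, dist_self] at hu
    exact hr.ne hu
  have hαsub : ∀ u v, α '' Icc u v ⊆ range α := fun u v ↦ image_subset_range _ _
  have hβsub : ∀ u v, β '' Icc u v ⊆ range β := fun u v ↦ image_subset_range _ _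
  have hα₁ : α '' Icc 0 s₁ ∩ Metric.closedBall p r ⊆ {α s₁} := by
    rintro _ ⟨⟨u, hu, rfl⟩, hx⟩
    exact congrArg α (hu.2.eq_of_not_lt fun h ↦ hs₁m u h hx)
  have hα₂ : α '' Icc s₂ 1 ∩ Metric.closedBall p r ⊆ {α s₂} := by
    rintro _ ⟨⟨u, hu, rfl⟩, hx⟩
    exact congrArg α (hu.1.eq_of_not_lt fun h ↦ hs₂m u h hx).symm
  have hβ₁ : β '' Icc 0 t₁ ∩ Metric.closedBall p r ⊆ {β t₁} := by
    rintro _ ⟨⟨u, hu, rfl⟩, hx⟩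
    exact congrArg β (hu.2.eq_of_not_lt fun h ↦ ht₁m u h hx)
  have hβ₂ : β '' Icc t₂ 1 ∩ Metric.closedBall p r ⊆ {β t₂} := by
    rintro _ ⟨⟨u, hu, rfl⟩, hx⟩
    exact congrArg β (hu.1.eq_of_not_lt fun h ↦ ht₂m u h hx).symm
  have hαα : Disjoint (α '' Icc 0 s₁) (α '' Icc s₂ 1) := by
    refine (disjoint_image_iff hα).2 (disjoint_left.2 fun u hu hu' ↦ ?_)
    exact ((hs₁.trans hs₂).trans_le hu'.1).not_ge hu.2
  have hββ : Disjoint (β '' Icc 0 t₁) (β '' Icc t₂ 1) := by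
    refine (disjoint_image_iff hβ).2 (disjoint_left.2 fun u hu hu' ↦ ?_)
    exact ((ht₁.trans ht₂).trans_le hu'.1).not_ge hu.2
  have hβα : Disjoint (β '' Icc 0 t₁) (α '' Icc s₂ 1) := by
    rw [disjoint_left]
    rintro _ ⟨u, hu, rfl⟩ ⟨v, hv, hv'⟩
    exact hmin u (hu.2.trans_lt ht₁) ⟨v, ⟨hs₂.le.trans hv.1, hv.2⟩, hv'⟩
  have hαβ : Disjoint (α '' Icc 0 s₁) (β '' Icc t₂ 1) := by
    rw [disjoint_left]
    rintro _ ⟨u, hu, rfl⟩ ⟨v, hv, hv'⟩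
    exact hmin' u (hu.2.trans_lt hs₁) ⟨v, ⟨ht₂.le.trans hv.1, hv.2⟩, hv'⟩
  have hsph : Metric.sphere p r ⊆ Metric.closedBall p r := Metric.sphere_subset_closedBall
  have hseg : ∀ {x y}, x ∈ Metric.sphere p r → y ∈ Metric.sphere p r →
      segment ℝ x y ⊆ Metric.closedBall p r :=
    fun hx hy ↦ (convex_closedBall p r).segment_subset (hsph hx) (hsph hy)
  have hBU : Metric.closedBall p r ⊆ U := fun x hx ↦ (hrU hx).1
  have hpB : p ∈ Metric.closedBall p r := Metric.mem_closedBall_self hr.le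
  have aα₁ := IsSimpleArc.of_subpath_zero hα hs₁0
  have aα₂ := IsSimpleArc.of_subpath_one hα hs₂1
  have aβ₁ := IsSimpleArc.of_subpath_zero hβ ht₁0
  have aβ₂ := IsSimpleArc.of_subpath_one hβ ht₂1
  -- the part of a rerouted arc inside the ball is the chord
  have inside : ∀ {X Y : Set E} {x y z : E}, X ∩ Metric.closedBall p r ⊆ {x} →
      Y ∩ Metric.closedBall p r ⊆ {y} → z ∈ X ∪ segment ℝ x y ∪ Y →
      z ∈ Metric.closedBall p r → z ∈ segment ℝ x y := by
    rintro X Y x y z hX hY ((hz | hz) | hz) hzB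
    · rw [show z = x from hX ⟨hz, hzB⟩]
      exact left_mem_segment ℝ x y
    · exact hz
    · rw [show z = y from hY ⟨hz, hzB⟩]
      exact right_mem_segment ℝ x y
  have outside : ∀ {X Y : Set E} {x y z : E}, x ∈ Metric.sphere p r → y ∈ Metric.sphere p r →
      z ∈ X ∪ segment ℝ x y ∪ Y → z ∉ Metric.closedBall p r → z ∈ X ∨ z ∈ Y := by
    rintro X Y x y z hx hy ((hz | hz) | hz) hzB
    · exact .inl hz
    · exact absurd (hseg hx hy hz) hzB
    · exact .inr hz
  have hsubU : ∀ {X Y : Set E} {x y : E}, x ∈ Metric.sphere p r → y ∈ Metric.sphere p r →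
      X ⊆ range α ∪ range β → Y ⊆ range α ∪ range β →
      X ∪ segment ℝ x y ∪ Y ⊆ range α ∪ range β ∪ U := by
    rintro X Y x y hx hy hX hY z ((hz | hz) | hz)
    · exact .inl (hX hz)
    · exact .inr (hBU (hseg hx hy hz))
    · exact .inl (hY hz)
  have hαu : ∀ u v, α '' Icc u v ⊆ range α ∪ range β :=
    fun u v ↦ (hαsub u v).trans subset_union_left
  have hβu : ∀ u v, β '' Icc u v ⊆ range α ∪ range β :=
    fun u v ↦ (hβsub u v).trans subset_union_right
  rcases disjoint_chords hs₁s hs₂s ht₁s ht₂s (hα.ne (hs₁.trans hs₂).ne) (hne _ _ hs₁s)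
    (hne _ _ hs₁s) (hne _ _ hs₂s) (hne _ _ hs₂s) (hβ.ne (ht₁.trans ht₂).ne) with hd | hd
  · refine ⟨_, _, aα₁.join_chord aα₂ hαα (hsph hs₁s) (hsph hs₂s) hα₁ hα₂,
      aβ₁.join_chord aβ₂ hββ (hsph ht₁s) (hsph ht₂s) hβ₁ hβ₂,
      hsubU hs₁s hs₂s (hαu _ _) (hαu _ _), hsubU ht₁s ht₂s (hβu _ _) (hβu _ _), ?_⟩
    rintro z ⟨hz₁, hz₂⟩
    have hzB : z ∉ Metric.closedBall p r := fun h ↦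
      disjoint_left.1 hd (inside hα₁ hα₂ hz₁ h) (inside hβ₁ hβ₂ hz₂ h)
    refine ⟨⟨?_, ?_⟩, fun h ↦ hzB (h ▸ hpB)⟩
    · exact (outside hs₁s hs₂s hz₁ hzB).elim (hαsub _ _ ·) (hαsub _ _ ·)
    · exact (outside ht₁s ht₂s hz₂ hzB).elim (hβsub _ _ ·) (hβsub _ _ ·)
  · refine ⟨_, _, aβ₁.join_chord aα₂ hβα (hsph ht₁s) (hsph hs₂s) hβ₁ hα₂,
      aα₁.join_chord aβ₂ hαβ (hsph hs₁s) (hsph ht₂s) hα₁ hβ₂,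
      hsubU ht₁s hs₂s (hβu _ _) (hαu _ _), hsubU hs₁s ht₂s (hαu _ _) (hβu _ _), ?_⟩
    rintro z ⟨hz₁, hz₂⟩
    have hzB : z ∉ Metric.closedBall p r := fun h ↦
      disjoint_left.1 hd (inside hβ₁ hα₂ hz₁ h) (inside hα₁ hβ₂ hz₂ h)
    refine ⟨?_, fun h ↦ hzB (h ▸ hpB)⟩
    rcases outside ht₁s hs₂s hz₁ hzB with h₁ | h₁ <;>
      rcases outside hs₁s ht₂s hz₂ hzB with h₂ | h₂
    · exact ⟨hαsub _ _ h₂, hβsub _ _ h₁⟩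
    · exact absurd h₂ (disjoint_left.1 hββ h₁)
    · exact absurd h₁ (disjoint_left.1 hαα h₂)
    · exact ⟨hαsub _ _ h₁, hβsub _ _ h₂⟩

end Uncrossing

end Arcs

namespace PlaneDrawing

open Set

section

variable {V : Type*} {G : SimpleGraph V}

/-- The closed arc of an edge, as a set of points. -/
def curve (D : PlaneDrawing G) (e : Sym2 V) : Set (ℝ × ℝ) :=
  {q | ∃ (u v : V) (h : G.Adj u v), s(u, v) = e ∧ q ∈ range (D.arc h)}

variable (D : PlaneDrawing G)

lemma curve_mk {u v : V} (h : G.Adj u v) : D.curve s(u, v) = range (D.arc h) := by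
  ext q
  refine ⟨?_, fun hq ↦ ⟨u, v, h, rfl, hq⟩⟩
  rintro ⟨x, y, h', he, hq⟩
  rcases Sym2.eq_iff.1 he with ⟨rfl, rfl⟩ | ⟨rfl, rfl⟩
  · exact hq
  · rw [D.arc_symm h, Path.symm_range] at hq
    exact hq

lemma isSimpleArc_curve {u v : V} (h : G.Adj u v) :
    IsSimpleArc (D.pos u) (D.pos v) (D.curve s(u, v)) :=
  ⟨D.arc h, D.arc_inj h, (D.curve_mk h).symm⟩

lemma pos_mem_curve {u v w : V} (h : G.Adj u v) (hw : D.pos w ∈ D.curve s(u, v)) :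
    w = u ∨ w = v := by
  rw [D.curve_mk h] at hw
  obtain ⟨t, ht⟩ := hw
  exact D.no_vertex_mem h w t ht

lemma isInteriorPoint_iff {u v : V} (h : G.Adj u v) {q : ℝ × ℝ} :
    D.IsInteriorPoint h q ↔ q ∈ D.curve s(u, v) ∧ q ∉ range D.pos := by
  rw [D.curve_mk h]
  constructor
  · rintro ⟨t, h0, h1, rfl⟩
    refine ⟨⟨t, rfl⟩, ?_⟩
    rintro ⟨w, hw⟩
    rcases D.no_vertex_mem h w t hw.symm with rfl | rfl
    · exact h0 (D.arc_inj h (hw.symm.trans (D.arc h).source.symm))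
    · exact h1 (D.arc_inj h (hw.symm.trans (D.arc h).target.symm))
  · rintro ⟨⟨t, rfl⟩, hq⟩
    refine ⟨t, ?_, ?_, rfl⟩
    · rintro rfl
      exact hq ⟨u, by simp⟩
    · rintro rfl
      exact hq ⟨v, by simp⟩

lemma mem_crossings_iff {q : ℝ × ℝ} : q ∈ D.crossings ↔ q ∉ range D.pos ∧
    ∃ e ∈ G.edgeSet, ∃ e' ∈ G.edgeSet, e ≠ e' ∧ q ∈ D.curve e ∧ q ∈ D.curve e' := by
  constructor
  · rintro ⟨u, v, x, y, h₁, h₂, hne, hq₁, hq₂⟩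
    rw [isInteriorPoint_iff] at hq₁ hq₂
    exact ⟨hq₁.2, _, h₁, _, h₂, hne, hq₁.1, hq₂.1⟩
  · rintro ⟨hq, e, he, e', he', hne, h₁, h₂⟩
    induction e with | _ u v
    induction e' with | _ x y
    exact ⟨u, v, x, y, he, he', hne, (D.isInteriorPoint_iff he).2 ⟨h₁, hq⟩,
      (D.isInteriorPoint_iff he').2 ⟨h₂, hq⟩⟩

lemma finite_curve_inter {e e' : Sym2 V} (he : e ∈ G.edgeSet) (he' : e' ∈ G.edgeSet)
    (hne : e ≠ e') : (D.curve e ∩ D.curve e').Finite := by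
  induction e with | _ u v
  induction e' with | _ x y
  rw [D.curve_mk he, D.curve_mk he']
  exact D.finite_inter he he' hne

lemma mem_range_pos_of_mem_curves {e₁ e₂ e₃ : Sym2 V} (h₁ : e₁ ∈ G.edgeSet)
    (h₂ : e₂ ∈ G.edgeSet) (h₃ : e₃ ∈ G.edgeSet) (h₁₂ : e₁ ≠ e₂) (h₁₃ : e₁ ≠ e₃) (h₂₃ : e₂ ≠ e₃)
    {q : ℝ × ℝ} (hq₁ : q ∈ D.curve e₁) (hq₂ : q ∈ D.curve e₂) (hq₃ : q ∈ D.curve e₃) :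
    q ∈ range D.pos := by
  by_contra hq
  induction e₁ with | _ u₁ v₁
  induction e₂ with | _ u₂ v₂
  induction e₃ with | _ u₃ v₃
  obtain ⟨t₁, h₁0, h₁1, ht₁⟩ := (D.isInteriorPoint_iff h₁).2 ⟨hq₁, hq⟩
  obtain ⟨t₂, h₂0, h₂1, ht₂⟩ := (D.isInteriorPoint_iff h₂).2 ⟨hq₂, hq⟩
  obtain ⟨t₃, h₃0, h₃1, ht₃⟩ := (D.isInteriorPoint_iff h₃).2 ⟨hq₃, hq⟩
  exact D.no_triple_point h₁ h₂ h₃ h₁₂ h₁₃ h₂₃ t₁ t₂ t₃ h₁0 h₁1 h₂0 h₂1 h₃0 h₃1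
    (ht₁.trans ht₂.symm) (ht₂.trans ht₃.symm)

lemma finite_common_points [Finite V] : {q | ∃ e ∈ G.edgeSet, ∃ e' ∈ G.edgeSet,
    e ≠ e' ∧ q ∈ D.curve e ∧ q ∈ D.curve e'}.Finite := by
  have : (⋃ z : {z : Sym2 V × Sym2 V // z.1 ∈ G.edgeSet ∧ z.2 ∈ G.edgeSet ∧ z.1 ≠ z.2},
      D.curve z.1.1 ∩ D.curve z.1.2).Finite :=
    finite_iUnion fun z ↦ D.finite_curve_inter z.2.1 z.2.2.1 z.2.2.2
  refine this.subset ?_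
  rintro q ⟨e, he, e', he', hne, h⟩
  exact mem_iUnion.2 ⟨⟨(e, e'), he, he', hne⟩, h⟩

lemma finite_crossings [Finite V] : D.crossings.Finite :=
  D.finite_common_points.subset fun _ hq ↦ (D.mem_crossings_iff.1 hq).2

/-- A drawing can be specified by giving the arcs as sets of points. -/
theorem exists_of_curves (pos : V → ℝ × ℝ) (hpos : Function.Injective pos)
    (C : Sym2 V → Set (ℝ × ℝ))
    (harc : ∀ ⦃u v⦄, G.Adj u v → IsSimpleArc (pos u) (pos v) (C s(u, v)))
    (hvertex : ∀ ⦃u v⦄, G.Adj u v → ∀ w, pos w ∈ C s(u, v) → w = u ∨ w = v)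
    (hfin : ∀ e ∈ G.edgeSet, ∀ e' ∈ G.edgeSet, e ≠ e' → (C e ∩ C e').Finite)
    (htriple : ∀ e₁ ∈ G.edgeSet, ∀ e₂ ∈ G.edgeSet, ∀ e₃ ∈ G.edgeSet, e₁ ≠ e₂ → e₁ ≠ e₃ →
      e₂ ≠ e₃ → ∀ q, q ∈ C e₁ → q ∈ C e₂ → q ∈ C e₃ → q ∈ range pos) :
    ∃ D : PlaneDrawing G, D.pos = pos ∧ ∀ e ∈ G.edgeSet, D.curve e = C e := by
  classical
  let _ : LinearOrder V := IsWellOrder.linearOrder WellOrderingRel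
  choose γ hγ hrange using harc
  let arc : ∀ ⦃u v : V⦄, G.Adj u v → Path (pos u) (pos v) :=
    fun u v h ↦ if u < v then γ h else (γ h.symm).symm
  have arc_range : ∀ ⦃u v : V⦄ (h : G.Adj u v), range (arc h) = C s(u, v) := by
    intro u v h
    simp only [arc]
    split_ifs
    · exact hrange h
    · rw [Path.symm_range, hrange h.symm, Sym2.eq_swap]
  have arc_inj : ∀ ⦃u v : V⦄ (h : G.Adj u v), Function.Injective (arc h) := by
    intro u v h
    simp only [arc]
    split_ifs
    · exact hγ h
    · exact (hγ h.symm).comp unitInterval.symm_bijective.injective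
  have mem : ∀ ⦃u v : V⦄ (h : G.Adj u v) (t : I), arc h t ∈ C s(u, v) :=
    fun u v h t ↦ arc_range h ▸ ⟨t, rfl⟩
  let D : PlaneDrawing G :=
    { pos := pos
      pos_inj := hpos
      arc := arc
      arc_symm := by
        intro u v h
        simp only [arc]
        rcases lt_trichotomy u v with huv | rfl | huv
        · rw [if_neg huv.not_gt, if_pos huv]
        · exact absurd h (G.irrefl)
        · rw [if_pos huv, if_neg huv.not_gt, Path.symm_symm]
      arc_inj := arc_inj
      no_vertex_mem := fun u v h w t ht ↦ hvertex h w (ht ▸ mem h t)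
      finite_inter := by
        intro u v x y h₁ h₂ hne
        rw [arc_range, arc_range]
        exact hfin _ h₁ _ h₂ hne
      no_triple_point := by
        intro u₁ v₁ u₂ v₂ u₃ v₃ h₁ h₂ h₃ h₁₂ h₁₃ h₂₃ t₁ t₂ t₃ h0 h1 _ _ _ _ e₁ e₂
        obtain ⟨w, hw⟩ := htriple _ h₁ _ h₂ _ h₃ h₁₂ h₁₃ h₂₃ (arc h₁ t₁) (mem h₁ t₁)
          (e₁ ▸ mem h₂ t₂) (e₁.trans e₂ ▸ mem h₃ t₃)
        rcases hvertex h₁ w (hw ▸ mem h₁ t₁) with rfl | rfl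
        · exact h0 (arc_inj h₁ (hw.symm.trans (arc h₁).source.symm))
        · exact h1 (arc_inj h₁ (hw.symm.trans (arc h₁).target.symm)) }
  refine ⟨D, rfl, fun e he ↦ ?_⟩
  induction e with | _ u v
  exact (D.curve_mk he).trans (arc_range he)

end

end PlaneDrawing

/-- The planar case of `exists_uncrossed_arcs`. -/
theorem exists_uncrossed_arcs_prod {a b c p : ℝ × ℝ} {S T U : Set (ℝ × ℝ)}
    (hS : IsSimpleArc a b S) (hT : IsSimpleArc a c T) (hb : b ∉ T) (hc : c ∉ S)
    (hfin : (S ∩ T).Finite) (hp : p ∈ S ∩ T) (hpa : p ≠ a) (hU : U ∈ nhds p) :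
    ∃ S' T', IsSimpleArc a b S' ∧ IsSimpleArc a c T' ∧ S' ⊆ S ∪ T ∪ U ∧ T' ⊆ S ∪ T ∪ U ∧
      S' ∩ T' ⊆ (S ∩ T) \ {p} := by
  let φ : ℝ × ℝ ≃ₜ ℂ := Complex.equivRealProdCLM.symm.toHomeomorph
  have back : ∀ {x y : ℝ × ℝ} {R : Set ℂ}, IsSimpleArc (φ x) (φ y) R →
      IsSimpleArc x y (φ ⁻¹' R) := by
    intro x y R hR
    have := hR.image φ.symm.continuous φ.symm.injective
    rwa [φ.symm_apply_apply, φ.symm_apply_apply, φ.image_symm] at this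
  have hinter : φ '' S ∩ φ '' T = φ '' (S ∩ T) := (Set.image_inter φ.injective).symm
  obtain ⟨S', T', hS', hT', hS'U, hT'U, hST⟩ := exists_uncrossed_arcs (p := φ p) (U := φ '' U)
    (hS.image φ.continuous φ.injective) (hT.image φ.continuous φ.injective)
    (by rwa [φ.injective.mem_set_image]) (by rwa [φ.injective.mem_set_image])
    (hinter ▸ hfin.image φ) (hinter ▸ Set.mem_image_of_mem φ hp) (φ.injective.ne hpa)
    (φ.isOpenMap.image_mem_nhds hU)
  rw [← Set.image_union, ← Set.image_union] at hS'U hT'U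
  refine ⟨_, _, back hS', back hT', ?_, ?_, ?_⟩
  · exact fun x hx ↦ φ.injective.mem_set_image.1 (hS'U hx)
  · exact fun x hx ↦ φ.injective.mem_set_image.1 (hT'U hx)
  · intro x hx
    obtain ⟨h₁, h₂⟩ := hST hx
    rw [hinter, φ.injective.mem_set_image] at h₁
    exact ⟨h₁, fun h ↦ h₂ (congrArg φ h)⟩

namespace PlaneDrawing

open Set

/-- A crossing of two adjacent edges can be removed without creating new crossings. -/
theorem exists_crossings_subset_diff {V : Type*} [Finite V] {G : SimpleGraph V}
    (D : PlaneDrawing G) {u v w : V} (huv : G.Adj u v) (huw : G.Adj u w) (hvw : v ≠ w)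
    {p : ℝ × ℝ} (hp : p ∉ range D.pos) (hpv : p ∈ D.curve s(u, v)) (hpw : p ∈ D.curve s(u, w)) :
    ∃ D' : PlaneDrawing G, D'.crossings ⊆ D.crossings \ {p} := by
  classical
  set e₀ := s(u, v) with he₀
  set f₀ := s(u, w) with hf₀
  have he₀G : e₀ ∈ G.edgeSet := huv
  have hf₀G : f₀ ∈ G.edgeSet := huw
  have hef : e₀ ≠ f₀ := by
    intro h
    exact hvw (Sym2.congr_right.1 h)
  let K : Set (ℝ × ℝ) :=
    range D.pos ∪ ⋃ e : {e : Sym2 V // e ∈ G.edgeSet ∧ e ≠ e₀ ∧ e ≠ f₀}, D.curve e.1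
  have hK : IsClosed K := by
    refine (finite_range D.pos).isClosed.union (isClosed_iUnion_of_finite ?_)
    rintro ⟨e, he, -⟩
    induction e with | _ x y
    exact (D.isSimpleArc_curve he).isCompact.isClosed
  have hpK : p ∉ K := by
    rintro (h | h)
    · exact hp h
    · obtain ⟨⟨e, he, h₁, h₂⟩, hpe⟩ := mem_iUnion.1 h
      exact hp (D.mem_range_pos_of_mem_curves he₀G hf₀G he hef h₁.symm h₂.symm hpv hpw hpe)
  have hvT : D.pos v ∉ D.curve f₀ := by
    intro h
    rcases D.pos_mem_curve huw h with h | h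
    · exact huv.ne h.symm
    · exact hvw h
  have hwS : D.pos w ∉ D.curve e₀ := by
    intro h
    rcases D.pos_mem_curve huv h with h | h
    · exact huw.ne h.symm
    · exact hvw h.symm
  obtain ⟨S', T', hS', hT', hS'U, hT'U, hST⟩ := exists_uncrossed_arcs_prod (U := Kᶜ)
    (D.isSimpleArc_curve huv) (D.isSimpleArc_curve huw) hvT hwS
    (D.finite_curve_inter he₀G hf₀G hef) ⟨hpv, hpw⟩ (fun h ↦ hp ⟨u, h.symm⟩)
    (hK.isOpen_compl.mem_nhds hpK)
  rw [← he₀, ← hf₀] at hS'U hT'U hST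
  let C : Sym2 V → Set (ℝ × ℝ) := fun e ↦ if e = e₀ then S' else if e = f₀ then T' else D.curve e
  have hCe : C e₀ = S' := if_pos rfl
  have hCf : C f₀ = T' := by simp [C, hef.symm]
  have hC : ∀ e, e ≠ e₀ → e ≠ f₀ → C e = D.curve e := fun e h₁ h₂ ↦ by simp [C, h₁, h₂]
  have hK' : ∀ q ∈ K, q ∈ S' ∪ T' → q ∈ D.curve e₀ ∪ D.curve f₀ := by
    rintro q hq (h | h)
    · exact (hS'U h).resolve_right fun h' ↦ h' hq
    · exact (hT'U h).resolve_right fun h' ↦ h' hq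
  have hperm : ∀ e ∈ G.edgeSet, ∀ e' ∈ G.edgeSet, e ≠ e' → ∀ q ∈ C e, q ∈ C e' → q ≠ p ∧
      ∃ τ : Sym2 V → Sym2 V, Function.Injective τ ∧ (∀ g ∈ G.edgeSet, τ g ∈ G.edgeSet) ∧
        ∀ g ∈ G.edgeSet, q ∈ C g → q ∈ D.curve (τ g) := by
    intro e he e' he' hne q hq hq'
    have build : ∀ τ : Equiv.Perm (Sym2 V), (τ e₀ ∈ G.edgeSet) → (τ f₀ ∈ G.edgeSet) →
        (∀ g, g ≠ e₀ → g ≠ f₀ → τ g = g) → (q ∈ S' → q ∈ D.curve (τ e₀)) →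
        (q ∈ T' → q ∈ D.curve (τ f₀)) →
        ∃ τ : Sym2 V → Sym2 V, Function.Injective τ ∧ (∀ g ∈ G.edgeSet, τ g ∈ G.edgeSet) ∧
          ∀ g ∈ G.edgeSet, q ∈ C g → q ∈ D.curve (τ g) := by
      intro τ h₁ h₂ h₃ h₄ h₅
      refine ⟨τ, τ.injective, fun g hg ↦ ?_, fun g hg hgq ↦ ?_⟩ <;>
        by_cases hge : g = e₀ <;> by_cases hgf : g = f₀
      · rwa [hge]
      · rwa [hge]
      · rwa [hgf]
      · rwa [h₃ g hge hgf]
      · exact absurd (hge.symm.trans hgf) hef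
      · rw [hge] at hgq ⊢
        exact h₄ (hCe ▸ hgq)
      · rw [hgf] at hgq ⊢
        exact h₅ (hCf ▸ hgq)
      · rw [h₃ g hge hgf]
        rwa [hC g hge hgf] at hgq
    by_cases hboth : q ∈ S' ∧ q ∈ T'
    · have h := hST hboth
      exact ⟨h.2, build 1 he₀G hf₀G (fun _ _ _ ↦ rfl) (fun _ ↦ h.1.1) (fun _ ↦ h.1.2)⟩
    have hqK : q ∈ K := by
      have hother : ∀ g ∈ G.edgeSet, g ≠ e₀ → g ≠ f₀ → q ∈ C g → q ∈ K :=
        fun g hg h₁ h₂ h ↦ .inr (mem_iUnion.2 ⟨⟨g, hg, h₁, h₂⟩, hC g h₁ h₂ ▸ h⟩)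
      have := hother e he
      have := hother e' he'
      grind
    refine ⟨fun h ↦ hpK (h ▸ hqK), ?_⟩
    by_cases hid : (q ∈ S' → q ∈ D.curve e₀) ∧ (q ∈ T' → q ∈ D.curve f₀)
    · exact build 1 he₀G hf₀G (fun _ _ _ ↦ rfl) hid.1 hid.2
    · have hU := hK' q hqK
      refine build (Equiv.swap e₀ f₀) (by simpa) (by simpa)
        (fun g h₁ h₂ ↦ Equiv.swap_apply_of_ne_of_ne h₁ h₂) ?_ ?_ <;>
      · simp only [Equiv.swap_apply_left, Equiv.swap_apply_right]
        simp only [mem_union] at hU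
        tauto
  have harc : ∀ ⦃x y⦄, G.Adj x y → IsSimpleArc (D.pos x) (D.pos y) (C s(x, y)) := by
    intro x y h
    by_cases h₁ : s(x, y) = e₀
    · rw [h₁, hCe]
      rcases Sym2.eq_iff.1 h₁ with ⟨rfl, rfl⟩ | ⟨rfl, rfl⟩
      exacts [hS', hS'.symm]
    by_cases h₂ : s(x, y) = f₀
    · rw [h₂, hCf]
      rcases Sym2.eq_iff.1 h₂ with ⟨rfl, rfl⟩ | ⟨rfl, rfl⟩
      exacts [hT', hT'.symm]
    rw [hC _ h₁ h₂]
    exact D.isSimpleArc_curve h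
  have hvertex : ∀ ⦃x y⦄, G.Adj x y → ∀ z, D.pos z ∈ C s(x, y) → z = x ∨ z = y := by
    intro x y h z hz
    have hzK : D.pos z ∈ K := .inl ⟨z, rfl⟩
    rw [← Sym2.mem_iff]
    by_cases h₁ : s(x, y) = e₀
    · rw [h₁, hCe] at hz
      rw [h₁]
      have hzw : z ≠ w := by
        rintro rfl
        exact hwS (hST ⟨hz, hT'.right_mem⟩).1.1
      rcases hK' _ hzK (.inl hz) with h' | h'
      · exact Sym2.mem_iff.2 (D.pos_mem_curve huv h')
      · exact Sym2.mem_iff.2 (.inl ((D.pos_mem_curve huw h').resolve_right hzw))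
    by_cases h₂ : s(x, y) = f₀
    · rw [h₂, hCf] at hz
      rw [h₂]
      have hzv : z ≠ v := by
        rintro rfl
        exact hvT (hST ⟨hS'.right_mem, hz⟩).1.2
      rcases hK' _ hzK (.inr hz) with h' | h'
      · exact Sym2.mem_iff.2 (.inl ((D.pos_mem_curve huv h').resolve_right hzv))
      · exact Sym2.mem_iff.2 (D.pos_mem_curve huw h')
    rw [hC _ h₁ h₂] at hz
    exact Sym2.mem_iff.2 (D.pos_mem_curve h hz)
  have hcommon : ∀ e ∈ G.edgeSet, ∀ e' ∈ G.edgeSet, e ≠ e' → ∀ q ∈ C e, q ∈ C e' → q ≠ p ∧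
      ∃ g ∈ G.edgeSet, ∃ g' ∈ G.edgeSet, g ≠ g' ∧ q ∈ D.curve g ∧ q ∈ D.curve g' := by
    intro e he e' he' hne q hq hq'
    obtain ⟨hqp, τ, hτ, hτG, hτq⟩ := hperm e he e' he' hne q hq hq'
    exact ⟨hqp, τ e, hτG e he, τ e', hτG e' he', hτ.ne hne, hτq e he hq, hτq e' he' hq'⟩
  obtain ⟨D', hpos, hcurve⟩ := exists_of_curves D.pos D.pos_inj C harc hvertex
    (fun e he e' he' hne ↦ D.finite_common_points.subset
      fun q hq ↦ (hcommon e he e' he' hne q hq.1 hq.2).2)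
    (fun e₁ h₁ e₂ h₂ e₃ h₃ h₁₂ h₁₃ h₂₃ q hq₁ hq₂ hq₃ ↦ by
      obtain ⟨-, τ, hτ, hτG, hτq⟩ := hperm e₁ h₁ e₂ h₂ h₁₂ q hq₁ hq₂
      exact D.mem_range_pos_of_mem_curves (hτG _ h₁) (hτG _ h₂) (hτG _ h₃) (hτ.ne h₁₂)
        (hτ.ne h₁₃) (hτ.ne h₂₃) (hτq _ h₁ hq₁) (hτq _ h₂ hq₂) (hτq _ h₃ hq₃))
  refine ⟨D', fun q hq ↦ ?_⟩
  obtain ⟨hqpos, e, he, e', he', hne, hq, hq'⟩ := D'.mem_crossings_iff.1 hq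
  rw [hcurve e he] at hq
  rw [hcurve e' he'] at hq'
  obtain ⟨hqp, h⟩ := hcommon e he e' he' hne q hq hq'
  exact ⟨D.mem_crossings_iff.2 ⟨hpos ▸ hqpos, h⟩, hqp⟩

end PlaneDrawing

namespace PlaneDrawing

open Set

variable {V : Type*} {G : SimpleGraph V}

/-- The restriction of a drawing to an induced subgraph. -/
def induce (D : PlaneDrawing G) (s : Set V) : PlaneDrawing (G.induce s) where
  pos x := D.pos x
  pos_inj := D.pos_inj.comp Subtype.val_injective
  arc _ _ h := D.arc (SimpleGraph.induce_adj.1 h)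
  arc_symm _ _ h := D.arc_symm (SimpleGraph.induce_adj.1 h)
  arc_inj _ _ h := D.arc_inj (SimpleGraph.induce_adj.1 h)
  no_vertex_mem u v h w t ht := by
    simpa [Subtype.ext_iff] using D.no_vertex_mem (SimpleGraph.induce_adj.1 h) w t ht
  finite_inter u v x y h₁ h₂ hne :=
    D.finite_inter (SimpleGraph.induce_adj.1 h₁) (SimpleGraph.induce_adj.1 h₂)
      fun h ↦ hne (Sym2.map.injective Subtype.val_injective (by simpa using h))
  no_triple_point u₁ v₁ u₂ v₂ u₃ v₃ h₁ h₂ h₃ h₁₂ h₁₃ h₂₃ :=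
    D.no_triple_point (SimpleGraph.induce_adj.1 h₁) (SimpleGraph.induce_adj.1 h₂)
      (SimpleGraph.induce_adj.1 h₃)
      (fun h ↦ h₁₂ (Sym2.map.injective Subtype.val_injective (by simpa using h)))
      (fun h ↦ h₁₃ (Sym2.map.injective Subtype.val_injective (by simpa using h)))
      (fun h ↦ h₂₃ (Sym2.map.injective Subtype.val_injective (by simpa using h)))

/-- The vertices of the edges passing through a point. -/
def vertexSupport (D : PlaneDrawing G) (q : ℝ × ℝ) : Set V :=
  {x | ∃ e ∈ G.edgeSet, x ∈ e ∧ q ∈ D.curve e}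

variable (D : PlaneDrawing G)

lemma crossings_induce_subset (s : Set V) :
    (D.induce s).crossings ⊆ {q ∈ D.crossings | D.vertexSupport q ⊆ s} := by
  rintro q ⟨u, v, x, y, h₁, h₂, hne, hq₁, hq₂⟩
  have hne' : s((u : V), (v : V)) ≠ s((x : V), (y : V)) :=
    fun h ↦ hne (Sym2.map.injective Subtype.val_injective (by simpa using h))
  have g₁ : G.Adj u v := SimpleGraph.induce_adj.1 h₁
  have g₂ : G.Adj x y := SimpleGraph.induce_adj.1 h₂
  have i₁ : D.IsInteriorPoint g₁ q := hq₁
  have i₂ : D.IsInteriorPoint g₂ q := hq₂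
  refine ⟨⟨u, v, x, y, g₁, g₂, hne', i₁, i₂⟩, ?_⟩
  rw [isInteriorPoint_iff] at i₁ i₂
  rintro z ⟨e, he, hze, hq⟩
  by_cases h₁ : e = s((u : V), (v : V))
  · subst h₁
    rcases Sym2.mem_iff.1 hze with rfl | rfl
    exacts [u.2, v.2]
  by_cases h₂ : e = s((x : V), (y : V))
  · subst h₂
    rcases Sym2.mem_iff.1 hze with rfl | rfl
    exacts [x.2, y.2]
  exact absurd (D.mem_range_pos_of_mem_curves g₁ g₂ he hne' (Ne.symm h₁) (Ne.symm h₂)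
    i₁.1 i₂.1 hq) i₁.2

/-- In a drawing with the least number of crossings, adjacent edges do not cross. -/
lemma disjoint_of_minimal [Finite V] (hD : D.crossingCount = crossingNumber G) {q : ℝ × ℝ}
    (hq : q ∉ range D.pos) {e e' : Sym2 V} (he : e ∈ G.edgeSet) (he' : e' ∈ G.edgeSet)
    (hne : e ≠ e') (hqe : q ∈ D.curve e) (hqe' : q ∈ D.curve e') {x : V} (hx : x ∈ e) :
    x ∉ e' := by
  intro hx'
  obtain ⟨v, rfl⟩ := hx
  obtain ⟨w, rfl⟩ := hx'
  have hvw : v ≠ w := fun h ↦ hne (by rw [h])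
  obtain ⟨D', hD'⟩ := D.exists_crossings_subset_diff he he' hvw hq hqe hqe'
  have hmem : q ∈ D.crossings := D.mem_crossings_iff.2 ⟨hq, _, he, _, he', hne, hqe, hqe'⟩
  have hlt : D'.crossingCount < D.crossingCount :=
    ncard_lt_ncard ⟨hD'.trans sdiff_subset, fun h ↦ (hD' (h hmem)).2 rfl⟩ D.finite_crossings
  have hle : crossingNumber G ≤ D'.crossingCount := Nat.sInf_le ⟨D', rfl⟩
  omega

lemma four_le_ncard_vertexSupport [Finite V] (hD : D.crossingCount = crossingNumber G)
    {q : ℝ × ℝ} (hq : q ∈ D.crossings) : 4 ≤ (D.vertexSupport q).ncard := by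
  obtain ⟨hqpos, e, he, e', he', hne, hqe, hqe'⟩ := D.mem_crossings_iff.1 hq
  have hdis : ∀ x ∈ e, x ∉ e' := fun x hx ↦
    D.disjoint_of_minimal hD hqpos he he' hne hqe hqe' hx
  induction e with | _ u v
  induction e' with | _ x y
  have huv : u ≠ v := G.ne_of_adj he
  have hxy : x ≠ y := G.ne_of_adj he'
  have hu := hdis u (Sym2.mem_mk_left u v)
  have hv := hdis v (Sym2.mem_mk_right u v)
  rw [Sym2.mem_iff, not_or] at hu hv
  have hcard : ({u, v, x, y} : Set V).ncard = 4 := by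
    classical
    have : ({u, v, x, y} : Set V) = (({u, v, x, y} : Finset V) : Set V) := by simp
    rw [this, ncard_coe_finset]
    simp [Finset.card_insert_of_notMem, huv, hxy, hu, hv]
  rw [← hcard]
  refine ncard_le_ncard ?_ (toFinite _)
  rintro z (rfl | rfl | rfl | rfl)
  · exact ⟨_, he, Sym2.mem_mk_left _ _, hqe⟩
  · exact ⟨_, he, Sym2.mem_mk_right _ _, hqe⟩
  · exact ⟨_, he', Sym2.mem_mk_left _ _, hqe'⟩
  · exact ⟨_, he', Sym2.mem_mk_right _ _, hqe'⟩

end PlaneDrawing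

section RandomSubset

variable {V : Type*} [Fintype V] [DecidableEq V]

/-- The probability that a random subset, containing every element independently with
probability `p`, equals `S`. -/
def subsetWeight (p : ℝ) (S : Finset V) : ℝ :=
  (∏ _i ∈ S, p) * ∏ _i ∈ Finset.univ \ S, (1 - p)

lemma subsetWeight_nonneg {p : ℝ} (h0 : 0 ≤ p) (h1 : p ≤ 1) (S : Finset V) :
    0 ≤ subsetWeight p S :=
  mul_nonneg (Finset.prod_nonneg fun _ _ ↦ h0) (Finset.prod_nonneg fun _ _ ↦ sub_nonneg.2 h1)

lemma sum_subsetWeight_superset (p : ℝ) (T : Finset V) :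
    ∑ S : Finset V, (if T ⊆ S then subsetWeight p S else 0) = p ^ T.card := by
  have h := Finset.prod_add (fun _ : V ↦ p) (fun i ↦ if i ∈ T then 0 else 1 - p) Finset.univ
  have hl : ∏ i : V, (p + if i ∈ T then 0 else 1 - p) = p ^ T.card := by
    have : ∀ i : V, (p + if i ∈ T then 0 else 1 - p) = if i ∈ T then p else 1 := by
      intro i
      split_ifs <;> ring
    simp_rw [this]
    simp [Finset.prod_ite_mem]
  rw [← hl, h, Finset.powerset_univ]
  refine Finset.sum_congr rfl fun S _ ↦ ?_
  split_ifs with hTS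
  · rw [subsetWeight]
    congr 1
    refine Finset.prod_congr rfl fun i hi ↦ ?_
    rw [if_neg fun hiT ↦ (Finset.mem_sdiff.1 hi).2 (hTS hiT)]
  · obtain ⟨i, hiT, hiS⟩ := Finset.not_subset.1 hTS
    rw [Finset.prod_eq_zero (s := Finset.univ \ S) (i := i) (by simp [hiS]) (by simp [hiT]),
      mul_zero]

/-- The expected number of members of a family of sets contained in a random subset. -/
lemma sum_subsetWeight_mul_card {ι : Type*} (p : ℝ) (J : Finset ι) (f : ι → Finset V) :
    ∑ S : Finset V, subsetWeight p S * ((J.filter fun j ↦ f j ⊆ S).card : ℝ) =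
      ∑ j ∈ J, p ^ (f j).card := by
  simp_rw [← sum_subsetWeight_superset p, Finset.card_filter, Nat.cast_sum, Finset.mul_sum]
  rw [Finset.sum_comm]
  simp

end RandomSubset

lemma ncard_edgeSet_induce {V : Type*} [Fintype V] [DecidableEq V] (G : SimpleGraph V)
    (S : Finset V) [Fintype G.edgeSet] :
    (G.induce (S : Set V)).edgeSet.ncard =
      (G.edgeFinset.filter fun e ↦ e.toFinset ⊆ S).card := by
  rw [← Set.ncard_image_of_injective _ (Sym2.map.injective Subtype.val_injective),
    ← Set.ncard_coe_finset]
  congr 1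
  ext e
  simp only [Set.mem_image, Finset.coe_filter, SimpleGraph.mem_edgeFinset, Set.mem_ofPred_eq]
  constructor
  · rintro ⟨e, he, rfl⟩
    induction e with | _ u v
    refine ⟨SimpleGraph.induce_adj.1 he, fun x hx ↦ ?_⟩
    rw [Sym2.mem_toFinset, Sym2.map_mk, Sym2.mem_iff] at hx
    rcases hx with rfl | rfl
    exacts [u.2, v.2]
  · rintro ⟨he, hS⟩
    induction e with | _ u v
    have hu : u ∈ S := hS (by simp)
    have hv : v ∈ S := hS (by simp)
    exact ⟨s(⟨u, hu⟩, ⟨v, hv⟩), SimpleGraph.induce_adj.2 he, rfl⟩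

/-- The probabilistic amplification of a linear lower bound on crossing numbers of induced
subgraphs. -/
lemma crossingNumber_amplify {V : Type*} [Fintype V] (G : SimpleGraph V) (D : PlaneDrawing G)
    (hD : D.crossingCount = crossingNumber G) {a b p : ℝ} (h0 : 0 ≤ p) (h1 : p ≤ 1)
    (hcr : ∀ S : Finset V, a * (G.induce (S : Set V)).edgeSet.ncard - b * S.card ≤
      (crossingNumber (G.induce (S : Set V)) : ℝ)) :
    a * (p ^ 2 * G.edgeSet.ncard) - b * (p * Fintype.card V) ≤ p ^ 4 * crossingNumber G := by
  classical
  let X : Finset (ℝ × ℝ) := D.finite_crossings.toFinset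
  let f : ℝ × ℝ → Finset V := fun q ↦ (D.vertexSupport q).toFinset
  have hX : X.card = crossingNumber G := by
    rw [← hD, PlaneDrawing.crossingCount, Set.ncard_eq_toFinset_card _ D.finite_crossings]
  have hind : ∀ S : Finset V,
      crossingNumber (G.induce (S : Set V)) ≤ (X.filter fun q ↦ f q ⊆ S).card := by
    intro S
    have hle : crossingNumber (G.induce (S : Set V)) ≤ (D.induce (S : Set V)).crossingCount :=
      Nat.sInf_le ⟨_, rfl⟩
    refine hle.trans ?_
    rw [PlaneDrawing.crossingCount, ← Set.ncard_coe_finset]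
    refine Set.ncard_le_ncard ((D.crossings_induce_subset S).trans fun q hq ↦ ?_)
      (Finset.finite_toSet _)
    simpa [X, f, Set.toFinset_subset] using hq
  have hvert : ∑ S : Finset V, subsetWeight p S * (S.card : ℝ) = p * Fintype.card V := by
    have := sum_subsetWeight_mul_card p (Finset.univ : Finset V) fun x ↦ {x}
    simpa [mul_comm] using this
  have hedge : ∑ S : Finset V,
      subsetWeight p S * ((G.induce (S : Set V)).edgeSet.ncard : ℝ) =
        p ^ 2 * G.edgeSet.ncard := by
    simp_rw [ncard_edgeSet_induce]
    rw [sum_subsetWeight_mul_card, Finset.sum_congr rfl (g := fun _ ↦ p ^ 2)]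
    · rw [Finset.sum_const, nsmul_eq_mul, mul_comm, ← Set.ncard_coe_finset,
        SimpleGraph.coe_edgeFinset]
    · intro e he
      rw [Sym2.card_toFinset_of_not_isDiag _
        (G.not_isDiag_of_mem_edgeSet (SimpleGraph.mem_edgeFinset.1 he))]
  calc a * (p ^ 2 * G.edgeSet.ncard) - b * (p * Fintype.card V)
      = ∑ S : Finset V, subsetWeight p S *
          (a * (G.induce (S : Set V)).edgeSet.ncard - b * S.card) := by
        rw [← hvert, ← hedge, Finset.mul_sum, Finset.mul_sum, ← Finset.sum_sub_distrib]
        exact Finset.sum_congr rfl fun S _ ↦ by ring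
    _ ≤ ∑ S : Finset V, subsetWeight p S * ((X.filter fun q ↦ f q ⊆ S).card : ℝ) :=
        Finset.sum_le_sum fun S _ ↦ mul_le_mul_of_nonneg_left
          ((hcr S).trans (Nat.cast_le.2 (hind S))) (subsetWeight_nonneg h0 h1 S)
    _ = ∑ q ∈ X, p ^ (f q).card := sum_subsetWeight_mul_card p X f
    _ ≤ ∑ _q ∈ X, p ^ 4 := by
        refine Finset.sum_le_sum fun q hq ↦ pow_le_pow_of_le_one h0 h1 ?_
        rw [← Set.ncard_eq_toFinset_card']
        exact D.four_le_ncard_vertexSupport hD (D.finite_crossings.mem_toFinset.1 hq)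
    _ = p ^ 4 * crossingNumber G := by rw [Finset.sum_const, nsmul_eq_mul, hX, mul_comm]

theorem stmt_0
    (𝒳 : ∀ (V : Type) [Fintype V], SimpleGraph V → Prop)
    (hered : ∀ (V : Type) [Fintype V] (G : SimpleGraph V), 𝒳 V G →
      ∀ s : Finset V, 𝒳 ↥(s : Set V) (G.induce ↑s))
    (a b : ℝ) (ha : 0 < a) (hb : 0 < b)
    (hcr : ∀ (V : Type) [Fintype V] (H : SimpleGraph V), 𝒳 V H →
      (crossingNumber H : ℝ) ≥ a * H.edgeSet.ncard - b * Fintype.card V)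
    (V : Type) [Fintype V] (G : SimpleGraph V) (hG : 𝒳 V G)
    (hn : 1 ≤ Fintype.card V)
    (hm : 2 * a * G.edgeSet.ncard ≥ 3 * b * Fintype.card V) :
    (crossingNumber G : ℝ) ≥
      4 * a ^ 3 / (27 * b ^ 2) *
        ((G.edgeSet.ncard : ℝ) ^ 3 / (Fintype.card V : ℝ) ^ 2) := by
  have hN : (0 : ℝ) < Fintype.card V := by exact_mod_cast hn
  set N : ℝ := (Fintype.card V : ℝ)
  set M : ℝ := (G.edgeSet.ncard : ℝ)
  have hbN : 0 < b * N := mul_pos hb hN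
  have hM : 0 < M := by
    by_contra! h
    nlinarith
  have hpos : (0 : ℝ) < crossingNumber G := by
    have := hcr V G hG
    nlinarith
  obtain ⟨D, hD⟩ := Nat.sInf_mem (Nat.nonempty_of_pos_sInf (Nat.cast_pos.1 hpos))
  have haM : 0 < a * M := mul_pos ha hM
  set p : ℝ := 3 * (b * N) / (2 * (a * M)) with hp
  have hp0 : 0 < p := by positivity
  have hp1 : p ≤ 1 := by
    rw [hp, div_le_one (by positivity)]
    linarith
  have key := crossingNumber_amplify G D hD (a := a) (b := b) hp0.le hp1 fun S ↦ by
    have h := hcr _ _ (hered V G hG S)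
    rwa [← Nat.card_eq_fintype_card, Nat.card_coe_set_eq, Set.ncard_coe_finset] at h
  have hval : a * (p ^ 2 * M) - b * (p * N) =
      p ^ 4 * (4 * a ^ 3 / (27 * b ^ 2) * (M ^ 3 / N ^ 2)) := by
    rw [hp]
    field_simp
    ring
  rw [hval] at key
  exact le_of_mul_le_mul_left key (by positivity)
end

section
/- Let 𝒳 be a monotone family of finite simple graphs (i.e., closed under taking subgraphs and disjoint unions), let k be a positive integer, and for each integer i with 0 ≤ i ≤ k−1 let μ_i(n) be a function such that every i-planar graph in 𝒳 on n vertices has at most μ_i(n) edges. Then every graph G ∈ 𝒳 with n ≥ 4 vertices and m edges satisfies cr(G) ≥ k·m − Σ_{i=0}^{k−1} μ_i(n). -/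
open unitInterval

namespace PlaneDrawing

/-- The restriction of a drawing to a subgraph. -/
def restrict {V : Type*} {G H : SimpleGraph V} (D : PlaneDrawing G) (hle : H ≤ G) :
    PlaneDrawing H where
  pos := D.pos
  pos_inj := D.pos_inj
  arc _ _ h := D.arc (hle h)
  arc_symm _ _ h := D.arc_symm (hle h)
  arc_inj _ _ h := D.arc_inj (hle h)
  no_vertex_mem _ _ h := D.no_vertex_mem (hle h)
  finite_inter _ _ _ _ h₁ h₂ := D.finite_inter (hle h₁) (hle h₂)
  no_triple_point _ _ _ _ _ _ h₁ h₂ h₃ := D.no_triple_point (hle h₁) (hle h₂) (hle h₃)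

theorem finite_crossings_s1 {V : Type*} [Finite V] {G : SimpleGraph V} (D : PlaneDrawing G) :
    D.crossings.Finite := by
  have hfin : (⋃ (u : V) (v : V) (x : V) (y : V) (h₁ : G.Adj u v) (h₂ : G.Adj x y)
      (_ : s(u, v) ≠ s(x, y)), Set.range (D.arc h₁) ∩ Set.range (D.arc h₂)).Finite :=
    Set.finite_iUnion fun _ => Set.finite_iUnion fun _ => Set.finite_iUnion fun _ =>
      Set.finite_iUnion fun _ => Set.finite_iUnion fun h₁ => Set.finite_iUnion fun h₂ =>
        Set.finite_iUnion fun hne => D.finite_inter h₁ h₂ hne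
  refine hfin.subset ?_
  rintro p ⟨u, v, x, y, h₁, h₂, hne, ⟨t, -, -, ht⟩, ⟨t', -, -, ht'⟩⟩
  simp only [Set.mem_iUnion]
  exact ⟨u, v, x, y, h₁, h₂, hne, ⟨t, ht⟩, ⟨t', ht'⟩⟩

theorem edgeCrossings_subset {V : Type*} {G : SimpleGraph V} (D : PlaneDrawing G) {u v : V}
    (h : G.Adj u v) : D.edgeCrossings h ⊆ D.crossings := by
  rintro p ⟨hp, x, y, h₂, hne, hp₂⟩
  exact ⟨u, v, x, y, h, h₂, hne, hp, hp₂⟩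

/-- Deleting an edge destroys all crossings on that edge. -/
theorem crossingCount_restrict_deleteEdges_add_le {V : Type*} [Finite V] {G : SimpleGraph V}
    (D : PlaneDrawing G) {u v : V} (h : G.Adj u v) :
    (D.restrict (G.deleteEdges_le {s(u, v)})).crossingCount + (D.edgeCrossings h).ncard ≤
      D.crossingCount := by
  set D' := D.restrict (G.deleteEdges_le {s(u, v)}) with hD'
  have hdisj : Disjoint D'.crossings (D.edgeCrossings h) := by
    rw [Set.disjoint_left]
    rintro p ⟨a, b, c, d, h₁, h₂, hne, ⟨t₁, h10, h11, ht₁⟩, ⟨t₂, h20, h21, ht₂⟩⟩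
      ⟨⟨t, h0, h1, ht⟩, -⟩
    have hab := (SimpleGraph.deleteEdges_adj.1 h₁).2
    have hcd := (SimpleGraph.deleteEdges_adj.1 h₂).2
    exact D.no_triple_point (G.deleteEdges_le _ h₁) (G.deleteEdges_le _ h₂) h hne hab hcd
      t₁ t₂ t h10 h11 h20 h21 h0 h1 (ht₁.trans ht₂.symm) (ht₂.trans ht.symm)
  have hsub : D'.crossings ⊆ D.crossings := by
    rintro p ⟨a, b, c, d, h₁, h₂, hne, hp₁, hp₂⟩
    exact ⟨a, b, c, d, G.deleteEdges_le _ h₁, G.deleteEdges_le _ h₂, hne, hp₁, hp₂⟩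
  have hfin := D.finite_crossings_s1
  unfold crossingCount
  rw [← Set.ncard_union_eq hdisj (hfin.subset hsub) (hfin.subset (D.edgeCrossings_subset h))]
  exact Set.ncard_le_ncard (Set.union_subset hsub (D.edgeCrossings_subset h)) hfin

/-- The crossing lower bound for a drawing, for graphs in a class closed under subgraphs whose
`i`-planar members have at most `b i` edges. -/
theorem mul_ncard_edgeSet_sub_sum_le_crossingCount {V : Type*} [Finite V]
    (P : SimpleGraph V → Prop) (hP : ∀ G H : SimpleGraph V, P G → H ≤ G → P H) (b : ℕ → ℝ) :
    ∀ (k : ℕ), (∀ i < k, ∀ H : SimpleGraph V, P H → KPlanar H i → (H.edgeSet.ncard : ℝ) ≤ b i) →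
      ∀ (G : SimpleGraph V), P G → ∀ D : PlaneDrawing G,
        k * (G.edgeSet.ncard : ℝ) - ∑ i ∈ Finset.range k, b i ≤ D.crossingCount := by
  intro k
  induction k with
  | zero => intro _ G _ D; simp
  | succ k ihk =>
    intro hb G
    induction hm : G.edgeSet.ncard generalizing G with
    | zero =>
      intro hG D
      have hK : D.IsKPlane k := by
        intro u v h
        have hmem : s(u, v) ∈ G.edgeSet := h
        rw [(Set.ncard_eq_zero (Set.toFinite _)).1 hm] at hmem
        exact hmem.elim
      have h₁ := hb k k.lt_succ_self G hG ⟨D, hK⟩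
      have h₂ := ihk (fun i hi => hb i (hi.trans k.lt_succ_self)) G hG D
      rw [hm] at h₁ h₂
      rw [Finset.sum_range_succ]
      push_cast at *
      linarith
    | succ m ihm =>
      intro hG D
      by_cases hK : D.IsKPlane k
      · have h₁ := hb k k.lt_succ_self G hG ⟨D, hK⟩
        have h₂ := ihk (fun i hi => hb i (hi.trans k.lt_succ_self)) G hG D
        rw [hm] at h₁ h₂
        rw [Finset.sum_range_succ]
        push_cast at *
        linarith
      · unfold IsKPlane at hK
        push Not at hK
        obtain ⟨u, v, h, hlt⟩ := hK
        have hcard : (G.deleteEdges {s(u, v)}).edgeSet.ncard = m := by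
          have hmem : s(u, v) ∈ G.edgeSet := h
          rw [SimpleGraph.edgeSet_deleteEdges, Set.ncard_sdiff_singleton_of_mem hmem, hm]
          rfl
        have h₁ := ihm _ hcard (hP _ _ hG (G.deleteEdges_le _))
          (D.restrict (G.deleteEdges_le {s(u, v)}))
        have h₂ := D.crossingCount_restrict_deleteEdges_add_le h
        have h₃ : ((D.restrict (G.deleteEdges_le {s(u, v)})).crossingCount : ℝ) + (k + 1) ≤
            D.crossingCount := by
          exact_mod_cast (by omega)
        push_cast at *
        linarith

end PlaneDrawing

/-- Vanishes when the chords `ab`, `cd`, `ef` of the parabola `y = x ^ 2`, given by the abscissae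
of their endpoints, lie on concurrent lines. -/
def chordDet (a b c d e f : ℝ) : ℝ :=
  (a + b) * (c * d - e * f) + (c + d) * (e * f - a * b) + (e + f) * (a * b - c * d)

theorem chordDet_injective_of_nodup {a b c d e : ℝ} (h : [a, b, c, d, e].Nodup) {f f' : ℝ}
    (hf : chordDet a b c d e f = 0) (hf' : chordDet a b c d e f' = 0) : f = f' := by
  simp only [List.nodup_cons, List.mem_cons, List.not_mem_nil, or_false, not_or] at h
  obtain ⟨⟨hab, hac, had, hae⟩, ⟨hbc, hbd, hbe⟩, ⟨hcd, hce⟩, hde, -⟩ := h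
  unfold chordDet at hf hf'
  have hprod : (f - f') * (e * (c + d - (a + b)) + (a * b - c * d)) = 0 := by
    linear_combination hf - hf'
  rcases mul_eq_zero.1 hprod with h0 | h0
  · exact sub_eq_zero.1 h0
  · exfalso
    have h1 : (a + b - (c + d)) * ((e - a) * (e - b)) = 0 := by
      linear_combination hf - (f + e - a - b) * h0
    have hs : a + b - (c + d) = 0 := (mul_eq_zero.1 h1).resolve_right
      (mul_ne_zero (sub_ne_zero.2 (Ne.symm hae)) (sub_ne_zero.2 (Ne.symm hbe)))
    have h2 : (a - c) * (a - d) = 0 := by linear_combination (a - e) * hs - h0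
    exact mul_ne_zero (sub_ne_zero.2 hac) (sub_ne_zero.2 had) h2

theorem exists_finset_chordDet_ne_zero (n : ℕ) : ∃ S : Finset ℝ, S.card = n ∧
    ∀ a ∈ S, ∀ b ∈ S, ∀ c ∈ S, ∀ d ∈ S, ∀ e ∈ S, ∀ f ∈ S,
      [a, b, c, d, e, f].Nodup → chordDet a b c d e f ≠ 0 := by
  induction n with
  | zero => exact ⟨∅, by simp⟩
  | succ n ih =>
    obtain ⟨S, hcard, hS⟩ := ih
    have hfin : (⋃ a ∈ S, ⋃ b ∈ S, ⋃ c ∈ S, ⋃ d ∈ S, ⋃ e ∈ S, ⋃ (_ : [a, b, c, d, e].Nodup),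
        {f | chordDet a b c d e f = 0}).Finite :=
      S.finite_toSet.biUnion fun a _ => S.finite_toSet.biUnion fun b _ =>
        S.finite_toSet.biUnion fun c _ => S.finite_toSet.biUnion fun d _ =>
          S.finite_toSet.biUnion fun e _ => Set.finite_iUnion fun h =>
            Set.Subsingleton.finite fun _ hf _ hf' => chordDet_injective_of_nodup h hf hf'
    obtain ⟨y, hy⟩ := (S.finite_toSet.union hfin).infinite_compl.nonempty
    simp only [Set.mem_compl_iff, Set.mem_union, Set.mem_iUnion, not_or, not_exists,
      Finset.mem_coe, Set.mem_ofPred_eq] at hy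
    obtain ⟨hyS, hy⟩ := hy
    refine ⟨insert y S, by rw [Finset.card_insert_of_notMem hyS, hcard], ?_⟩
    have key : ∀ a ∈ S, ∀ b ∈ S, ∀ c ∈ S, ∀ d ∈ S, ∀ e ∈ S, [a, b, c, d, e].Nodup →
        chordDet a b c d e y ≠ 0 :=
      fun a ha b hb c hc d hd e he h h0 => hy a ha b hb c hc d hd e he h h0
    intro a ha b hb c hc d hd e he f hf hnd
    simp only [Finset.mem_insert] at ha hb hc hd he hf
    by_cases hmem : a ∈ S ∧ b ∈ S ∧ c ∈ S ∧ d ∈ S ∧ e ∈ S ∧ f ∈ S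
    · obtain ⟨ha, hb, hc, hd, he, hf⟩ := hmem
      exact hS a ha b hb c hc d hd e he f hf hnd
    simp only [List.nodup_cons, List.mem_cons, List.not_mem_nil, or_false, not_or] at hnd key
    have : y = a ∨ y = b ∨ y = c ∨ y = d ∨ y = e ∨ y = f := by grind
    unfold chordDet at key ⊢
    rcases this with rfl | rfl | rfl | rfl | rfl | rfl
    · have := key c (by grind) d (by grind) e (by grind) f (by grind) b (by grind) (by grind)
      exact fun h => this (by linear_combination h)
    · have := key c (by grind) d (by grind) e (by grind) f (by grind) a (by grind) (by grind)
      exact fun h => this (by linear_combination h)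
    · have := key e (by grind) f (by grind) a (by grind) b (by grind) d (by grind) (by grind)
      exact fun h => this (by linear_combination h)
    · have := key e (by grind) f (by grind) a (by grind) b (by grind) c (by grind) (by grind)
      exact fun h => this (by linear_combination h)
    · have := key a (by grind) b (by grind) c (by grind) d (by grind) f (by grind) (by grind)
      exact fun h => this (by linear_combination h)
    · have := key a (by grind) b (by grind) c (by grind) d (by grind) e (by grind) (by grind)
      exact fun h => this (by linear_combination h)

/-- The straight-line drawing with vertices on the parabola `y = x ^ 2`. -/
theorem exists_planeDrawing {V : Type*} [Fintype V] (G : SimpleGraph V) :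
    Nonempty (PlaneDrawing G) := by
  obtain ⟨S, hcard, hS⟩ := exists_finset_chordDet_ne_zero (Fintype.card V)
  obtain ⟨φ⟩ : Nonempty (V ≃ S) := Fintype.card_eq.1 (by simp [hcard])
  let x : V → ℝ := fun v => φ v
  have hx : Function.Injective x := Subtype.val_injective.comp φ.injective
  have hxS : ∀ v, x v ∈ S := fun v => (φ v).2
  let γ : ∀ u v : V, Path ((x u, x u ^ 2) : ℝ × ℝ) (x v, x v ^ 2) := fun u v =>
    { toFun := fun t => ((1 - (t : ℝ)) * x u + t * x v, (1 - (t : ℝ)) * x u ^ 2 + t * x v ^ 2)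
      continuous_toFun := by fun_prop
      source' := by simp
      target' := by simp }
  have hγ : ∀ u v t, γ u v t =
      ((1 - (t : ℝ)) * x u + t * x v, (1 - (t : ℝ)) * x u ^ 2 + t * x v ^ 2) := fun _ _ _ => rfl
  have hline : ∀ u v t, (γ u v t).2 = (x u + x v) * (γ u v t).1 - x u * x v := by
    intro u v t; rw [hγ]; ring
  have hne_of : ∀ {u v a b : V}, s(u, v) ≠ s(a, b) → x u + x v = x a + x b →
      x u * x v = x a * x b → False := by
    intro u v a b hne hs hp
    have h0 : (x u - x a) * (x u - x b) = 0 := by linear_combination x u * hs - hp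
    rcases mul_eq_zero.1 h0 with h | h
    · have h1 : u = a := hx (sub_eq_zero.1 h)
      have h2 : v = b := hx (by linear_combination hs - h)
      exact hne (by rw [h1, h2])
    · have h1 : u = b := hx (sub_eq_zero.1 h)
      have h2 : v = a := hx (by linear_combination hs - h)
      exact hne (by rw [h1, h2, Sym2.eq_swap])
  have ne_endpoint : ∀ {u v : V} {t : I}, G.Adj u v → t ≠ 0 → t ≠ 1 → ∀ {w : V},
      w = u ∨ w = v → (γ u v t).1 ≠ x w := by
    intro u v t h h0 h1 w hw heq
    have h0' : (t : ℝ) ≠ 0 := fun h => h0 (Subtype.ext h)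
    have h1' : (1 - t : ℝ) ≠ 0 := fun h => h1 (Subtype.ext (by simpa using (sub_eq_zero.1 h).symm))
    have huv : x u - x v ≠ 0 := sub_ne_zero.2 (hx.ne h.ne)
    rw [hγ] at heq
    rcases hw with rfl | rfl
    · exact mul_ne_zero h0' huv (by linear_combination -heq)
    · exact mul_ne_zero h1' huv (by linear_combination heq)
  have hdisj : ∀ {u v a b : V} {t r : I}, G.Adj u v → s(u, v) ≠ s(a, b) →
      t ≠ 0 → t ≠ 1 → γ u v t = γ a b r → x u ≠ x a ∧ x u ≠ x b ∧ x v ≠ x a ∧ x v ≠ x b := by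
    intro u v a b t r h hne h0 h1 heq
    have e1 := hline u v t
    have e2 := hline a b r
    rw [← heq] at e2
    have hu := sub_ne_zero.2 (ne_endpoint h h0 h1 (Or.inl rfl))
    have hv := sub_ne_zero.2 (ne_endpoint h h0 h1 (Or.inr rfl))
    have hprod : ((γ u v t).1 - x u) * ((γ u v t).1 - x v) =
        ((γ u v t).1 - x a) * ((γ u v t).1 - x b) := by linear_combination e1 - e2
    clear e1 e2
    generalize (γ u v t).1 = X at hu hv hprod
    refine ⟨fun hc => ?_, fun hc => ?_, fun hc => ?_, fun hc => ?_⟩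
    · have : x v = x b := mul_left_cancel₀ hu (by linear_combination -hprod - (X - x b) * hc)
      exact hne_of hne (by rw [hc, this]) (by rw [hc, this])
    · have : x v = x a := mul_left_cancel₀ hu (by linear_combination -hprod - (X - x a) * hc)
      exact hne_of hne (by rw [hc, this, add_comm]) (by rw [hc, this, mul_comm])
    · have : x u = x b := mul_left_cancel₀ hv (by linear_combination -hprod - (X - x b) * hc)
      exact hne_of hne (by rw [hc, this, add_comm]) (by rw [hc, this, mul_comm])
    · have : x u = x a := mul_left_cancel₀ hv (by linear_combination -hprod - (X - x a) * hc)
      exact hne_of hne (by rw [hc, this]) (by rw [hc, this])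
  exact ⟨{
    pos := fun v => (x v, x v ^ 2)
    pos_inj := fun u v h => hx (congrArg Prod.fst h)
    arc := fun u v _ => γ u v
    arc_symm := by
      intro u v h
      ext t
      · simp only [Path.symm_apply, Function.comp_apply, hγ, unitInterval.coe_symm_eq]; ring
      · simp only [Path.symm_apply, Function.comp_apply, hγ, unitInterval.coe_symm_eq]; ring
    arc_inj := by
      intro u v h t r heq
      have h1 := congrArg Prod.fst heq
      simp only [hγ] at h1
      have huv : x u - x v ≠ 0 := sub_ne_zero.2 (hx.ne h.ne)
      exact Subtype.ext (mul_right_cancel₀ huv (by linear_combination -h1))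
    no_vertex_mem := by
      intro u v h w t heq
      have e := hline u v t
      rw [heq] at e
      have h0 : (x w - x u) * (x w - x v) = 0 := by linear_combination e
      rcases mul_eq_zero.1 h0 with h | h
      · exact Or.inl (hx (sub_eq_zero.1 h))
      · exact Or.inr (hx (sub_eq_zero.1 h))
    finite_inter := by
      intro u v a b h₁ h₂ hne
      refine Set.Subsingleton.finite ?_
      rintro p ⟨⟨t, rfl⟩, ⟨r, hr⟩⟩ q ⟨⟨t', rfl⟩, ⟨r', hr'⟩⟩
      have e1 := hline u v t
      have e2 := hline a b r
      have e3 := hline u v t'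
      have e4 := hline a b r'
      rw [hr] at e2
      rw [hr'] at e4
      have hprod : (x u + x v - (x a + x b)) * ((γ u v t).1 - (γ u v t').1) = 0 := by
        linear_combination -e1 + e2 + e3 - e4
      rcases mul_eq_zero.1 hprod with h | h
      · exact (hne_of hne (sub_eq_zero.1 h)
          (by linear_combination (γ u v t).1 * h + e1 - e2)).elim
      · exact Prod.ext (sub_eq_zero.1 h) (by linear_combination e1 - e3 + (x u + x v) * h)
    no_triple_point := by
      intro u₁ v₁ u₂ v₂ u₃ v₃ h₁ h₂ h₃ n12 n13 n23 t₁ t₂ t₃ h10 h11 h20 h21 _ _ e12 e23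
      obtain ⟨p1, p2, p3, p4⟩ := hdisj h₁ n12 h10 h11 e12
      obtain ⟨q1, q2, q3, q4⟩ := hdisj h₁ n13 h10 h11 (e12.trans e23)
      obtain ⟨r1, r2, r3, r4⟩ := hdisj h₂ n23 h20 h21 e23
      have d1 := hx.ne h₁.ne
      have d2 := hx.ne h₂.ne
      have d3 := hx.ne h₃.ne
      refine hS _ (hxS u₁) _ (hxS v₁) _ (hxS u₂) _ (hxS v₂) _ (hxS u₃) _ (hxS v₃)
        (by simp [*]) ?_
      have e1 := hline u₁ v₁ t₁
      have e2 := hline u₂ v₂ t₂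
      have e3 := hline u₃ v₃ t₃
      rw [← e23, ← e12] at e3
      rw [← e12] at e2
      unfold chordDet
      linear_combination (x u₃ + x v₃ - x u₂ - x v₂) * e1 +
        (x u₁ + x v₁ - x u₃ - x v₃) * e2 + (x u₂ + x v₂ - x u₁ - x v₁) * e3 }⟩

theorem stmt_1
    (𝒳 : ∀ (V : Type) [Fintype V], SimpleGraph V → Prop)
    (hsub : ∀ (V : Type) [Fintype V] (G H : SimpleGraph V), 𝒳 V G → H ≤ G → 𝒳 V H)
    (hind : ∀ (V : Type) [Fintype V] (G : SimpleGraph V), 𝒳 V G →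
      ∀ s : Finset V, 𝒳 ↥(s : Set V) (G.induce ↑s))
    (hsum : ∀ (V W : Type) [Fintype V] [Fintype W]
      (G : SimpleGraph V) (H : SimpleGraph W),
      𝒳 V G → 𝒳 W H → 𝒳 (V ⊕ W) (G ⊕g H))
    (k : ℕ) (hk : 1 ≤ k) (μ : ℕ → ℕ → ℝ)
    (hμ : ∀ i < k, ∀ (V : Type) [Fintype V] (H : SimpleGraph V), 𝒳 V H →
      KPlanar H i → (H.edgeSet.ncard : ℝ) ≤ μ i (Fintype.card V))
    (V : Type) [Fintype V] (G : SimpleGraph V) (hG : 𝒳 V G)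
    (hn : 4 ≤ Fintype.card V) :
    (crossingNumber G : ℝ) ≥
      k * G.edgeSet.ncard - ∑ i ∈ Finset.range k, μ i (Fintype.card V) := by
  obtain ⟨D₀⟩ := exists_planeDrawing G
  obtain ⟨D, hD⟩ := Nat.sInf_mem
    (⟨_, D₀, rfl⟩ : {c : ℕ | ∃ D : PlaneDrawing G, D.crossingCount = c}.Nonempty)
  have h := PlaneDrawing.mul_ncard_edgeSet_sub_sum_le_crossingCount (𝒳 V) (hsub V)
    (fun i => μ i (Fintype.card V)) k (fun i hi H => hμ i hi V H) G hG D
  rw [hD] at h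
  exact h
end
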